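/- arXiv:math/0703383 — 2 statements merged into one kernel-verified Lean document; each statement's English description precedes it below -/
import Mathlib

section
/- For every integer l ≥ 2, the linear map α_l defined by α_l(e_1) = 0 and α_l(e_k) = e_{k+l} for k ≥ 2, and the inner derivation ad(e_l) : x ↦ [e_l,x], are derivations of 𝔪₀ of weight l, and every derivation of 𝔪₀ of weight l is a K-linear combination of α_l and ad(e_l). Likewise, the linear map γ defined by γ(e_1) = e_2 and γ(e_k) = 0 for k ≥ 2, and ad(e_1), are derivations of weight 1, and every derivation of 𝔪₀ of weight 1 is a K-linear combination of γ and ad(e_1). In particular, for every l ≥ 1 the space of weight-l derivations of 𝔪₀ is 2-dimensional. -/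
open Finsupp

variable (K : Type*) [Field K] [CharZero K]

/-- Underlying space of `𝔪₀`: index `n : ℕ` represents the basis vector `e_{n+1}`. -/
abbrev V := ℕ →₀ K

/-- `e K i` is the basis vector `e_i` of `𝔪₀` for `i ≥ 1`, and `0` for `i ≤ 0`. -/
noncomputable def e (i : ℤ) : V K :=
  if 1 ≤ i then Finsupp.single (i - 1).toNat 1 else 0

/-- Structure constants of `𝔪₀`: the value of the bracket `[e_{i+1}, e_{j+1}]`,
so that `[e_1, e_i] = e_{i+1}` for `i ≥ 2` and `[e_i, e_j] = 0` for `i, j ≥ 2`. -/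
noncomputable def m0c (i j : ℕ) : V K :=
  if i = 0 ∧ 1 ≤ j then Finsupp.single (j + 1) 1
  else if j = 0 ∧ 1 ≤ i then -Finsupp.single (i + 1) 1
  else 0

/-- The (bilinear, skew-symmetric) bracket of `𝔪₀`, extended bilinearly from its
values on basis vectors. -/
noncomputable def m0br (x y : V K) : V K :=
  x.sum fun i xi => y.sum fun j yj => (xi * yj) • m0c K i j

/-- `D` is a derivation of `𝔪₀` of weight `l`: a `K`-linear map satisfying the Leibniz
rule, such that `D e_i` is a scalar multiple of `e_{i+l}` for every `i ≥ 1`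
(in particular `D e_i = 0` whenever `i + l ≤ 0`, since then `e (i+l) = 0`). -/
def IsWeightDeriv (l : ℤ) (D : V K →ₗ[K] V K) : Prop :=
  (∀ x y : V K, D (m0br K x y) = m0br K (D x) y + m0br K x (D y)) ∧
  (∀ i : ℤ, 1 ≤ i → ∃ c : K, D (e K i) = c • e K (i + l))

/-- The linear map on `V` determined by prescribing the images of the basis vectors:
`basisMap K f` sends the basis vector with index `n` (i.e. `e_{n+1}`) to `f n`. -/
noncomputable def basisMap (f : ℕ → V K) : V K →ₗ[K] V K :=
  Finsupp.lsum K fun n => LinearMap.toSpanSingleton K (V K) (f n)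

/-- `ω₁`: `ω₁ e_1 = e_1`, `ω₁ e_2 = 0`, `ω₁ e_k = (k-2) e_k` for `k ≥ 3`. -/
noncomputable def omega1 : V K →ₗ[K] V K :=
  basisMap K fun n => if n = 0 then Finsupp.single 0 1
    else ((n : K) - 1) • Finsupp.single n 1

/-- `ω₂`: `ω₂ e_1 = 0`, `ω₂ e_k = e_k` for `k ≥ 2`. -/
noncomputable def omega2 : V K →ₗ[K] V K :=
  basisMap K fun n => if n = 0 then 0 else Finsupp.single n 1


/-- `α_l`: `α_l e_1 = 0`, `α_l e_k = e_{k+l}` for `k ≥ 2`. -/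
noncomputable def alphaMap (l : ℤ) : V K →ₗ[K] V K :=
  basisMap K fun n => if n = 0 then 0 else Finsupp.single ((n : ℤ) + l).toNat 1

/-- `γ`: `γ e_1 = e_2`, `γ e_k = 0` for `k ≥ 2`. -/
noncomputable def gammaMap : V K →ₗ[K] V K :=
  basisMap K fun n => if n = 0 then Finsupp.single 1 1 else 0

/-- The inner derivation `ad(e_{n+1}) : x ↦ [e_{n+1}, x]` of `𝔪₀`. -/
noncomputable def adE (n : ℕ) : V K →ₗ[K] V K :=
  basisMap K fun j => m0c K n j

omit [CharZero K] in
@[simp]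
lemma basisMap_single (f : ℕ → V K) (n : ℕ) : basisMap K f (single n 1) = f n := by
  simp [basisMap]

omit [CharZero K] in
/-- The bracket of `𝔪₀` expressed through `ad(e_1)`. -/
lemma m0br_eq (x y : V K) : m0br K x y = x 0 • adE K 0 y - y 0 • adE K 0 x := by
  have key : ∀ (i j : ℕ) (a b : K), (a * b) • m0c K i j =
      (single i a : V K) 0 • adE K 0 (single j b) - (single j b : V K) 0 • adE K 0 (single i a) := by
    intro i j a b
    rcases i with _ | i <;> rcases j with _ | j <;> simp [adE, basisMap, m0c, mul_comm]
  induction x using Finsupp.induction_linear with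
  | zero => simp [m0br]
  | add x₁ x₂ h₁ h₂ =>
    have : m0br K (x₁ + x₂) y = m0br K x₁ y + m0br K x₂ y := by
      unfold m0br
      rw [Finsupp.sum_add_index' (by simp)]
      intro i a b
      simp [Finsupp.sum, add_mul, add_smul, Finset.sum_add_distrib]
    rw [this, h₁, h₂, map_add, Finsupp.add_apply]
    module
  | single i a =>
    induction y using Finsupp.induction_linear with
    | zero => simp [m0br]
    | add y₁ y₂ h₁ h₂ =>
      have : m0br K (single i a) (y₁ + y₂) = m0br K (single i a) y₁ + m0br K (single i a) y₂ := by
        unfold m0br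
        rw [Finsupp.sum_single_index (by simp), Finsupp.sum_single_index (by simp),
          Finsupp.sum_single_index (by simp), Finsupp.sum_add_index' (by simp)]
        intro j b c
        rw [mul_add, add_smul]
      rw [this, h₁, h₂, map_add, Finsupp.add_apply]
      module
    | single j b =>
      rw [← key, m0br, Finsupp.sum_single_index (by simp), Finsupp.sum_single_index (by simp)]

omit [CharZero K] in
lemma adE_zero_single_zero : adE K 0 (single 0 1) = 0 := by simp [adE, m0c]

omit [CharZero K] in
lemma adE_zero_single_of_pos {n : ℕ} (hn : 1 ≤ n) :
    adE K 0 (single n 1) = single (n + 1) 1 := by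
  simp [adE, m0c, hn]

omit [CharZero K] in
lemma e_natCast_add_one (n : ℕ) : e K (n + 1) = single n 1 := by
  simp [e]

omit [CharZero K] in
lemma isWeightDeriv_iff {m : ℕ} (hm : 1 ≤ m) (D : V K →ₗ[K] V K) :
    IsWeightDeriv K m D ↔ ∃ a b : K, D (single 0 1) = a • single m 1 ∧
      ∀ n : ℕ, D (single (n + 1) 1) = b • single (n + 1 + m) 1 := by
  constructor
  · rintro ⟨hL, hw⟩
    have hw' : ∀ n : ℕ, ∃ c : K, D (single n 1) = c • single (n + m) 1 := by
      intro n
      obtain ⟨c, hc⟩ := hw (n + 1) (by omega)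
      refine ⟨c, ?_⟩
      rw [e_natCast_add_one, show (n : ℤ) + 1 + m = ((n + m : ℕ) : ℤ) + 1 by push_cast; ring,
        e_natCast_add_one] at hc
      exact hc
    obtain ⟨a, ha⟩ := hw' 0
    obtain ⟨b, hb⟩ := hw' 1
    refine ⟨a, b, by simpa using ha, fun n => ?_⟩
    induction n with
    | zero => simpa using hb
    | succ n ih =>
      have h := hL (single 0 1) (single (n + 1) 1)
      have hm0 : m ≠ 0 := by omega
      simp only [m0br_eq, ih, ha, map_smul, adE_zero_single_zero,
        adE_zero_single_of_pos K (show 1 ≤ n + 1 by omega),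
        adE_zero_single_of_pos K (show 1 ≤ n + 1 + m by omega)] at h
      rw [show n + 1 + 1 + m = n + 1 + m + 1 by ring]
      simpa [hm0] using h
  · rintro ⟨a, b, ha, hb⟩
    have hm0 : m ≠ 0 := by omega
    have h0 : ∀ x : V K, D x 0 = 0 := by
      intro x
      have : Finsupp.lapply 0 ∘ₗ D = (0 : V K →ₗ[K] K) := by
        ext n
        rcases n with _ | n <;> simp [ha, hb, hm0]
      exact LinearMap.congr_fun this x
    have hS : ∀ x : V K, D (adE K 0 x) - adE K 0 (D x) = x 0 • -(a • single (m + 1) 1) := by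
      intro x
      have : D ∘ₗ adE K 0 - adE K 0 ∘ₗ D =
          (Finsupp.lapply 0 : V K →ₗ[K] K).smulRight (-(a • single (m + 1) 1 : V K)) := by
        refine Finsupp.lhom_ext' fun n => LinearMap.ext_ring ?_
        rcases n with _ | n
        · simp only [LinearMap.comp_apply, LinearMap.sub_apply, Finsupp.lsingle_apply, ha,
            adE_zero_single_zero, map_smul, map_zero, adE_zero_single_of_pos K hm]
          simp
        · simp only [LinearMap.comp_apply, LinearMap.sub_apply, Finsupp.lsingle_apply, hb,
            adE_zero_single_of_pos K (show 1 ≤ n + 1 by omega), map_smul,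
            adE_zero_single_of_pos K (show 1 ≤ n + 1 + m by omega)]
          simp [show n + 1 + 1 + m = n + 1 + m + 1 by ring]
      exact LinearMap.congr_fun this x
    refine ⟨fun x y => ?_, fun i hi => ?_⟩
    · have hx := sub_eq_iff_eq_add.mp (hS x)
      have hy := sub_eq_iff_eq_add.mp (hS y)
      simp only [m0br_eq, h0, map_sub, map_smul, hx, hy]
      module
    · obtain ⟨n, rfl⟩ : ∃ n : ℕ, i = n + 1 := ⟨(i - 1).toNat, by omega⟩
      rw [e_natCast_add_one, show (n : ℤ) + 1 + m = ((n + m : ℕ) : ℤ) + 1 by push_cast; ring,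
        e_natCast_add_one]
      rcases n with _ | n
      · exact ⟨a, by simpa using ha⟩
      · exact ⟨b, hb n⟩

omit [CharZero K] in
lemma alphaMap_single_zero (l : ℤ) : alphaMap K l (single 0 1) = 0 := by simp [alphaMap]

omit [CharZero K] in
lemma alphaMap_natCast_single_succ (m n : ℕ) :
    alphaMap K m (single (n + 1) 1) = single (n + 1 + m) 1 := by
  rw [alphaMap, basisMap_single, if_neg n.succ_ne_zero, ← Nat.cast_add, Int.toNat_natCast]

omit [CharZero K] in
lemma adE_single_zero {n : ℕ} (hn : 1 ≤ n) : adE K n (single 0 1) = -single (n + 1) 1 := by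
  simp [adE, m0c, hn]

omit [CharZero K] in
lemma adE_single_succ {n : ℕ} (hn : 1 ≤ n) (j : ℕ) : adE K n (single (j + 1) 1) = 0 := by
  simp [adE, m0c, Nat.ne_of_gt hn]

omit [CharZero K] in
lemma gammaMap_single_zero : gammaMap K (single 0 1) = single 1 1 := by simp [gammaMap]

omit [CharZero K] in
lemma gammaMap_single_succ (n : ℕ) : gammaMap K (single (n + 1) 1) = 0 := by simp [gammaMap]

omit [CharZero K] in
/-- If `A` and `B` restrict to a nonzero multiple of the shift by `m` on, respectively, `e_1` and
the span of the other basis vectors, and vanish on the rest, then every derivation of weight `m`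
is uniquely a combination of `A` and `B`. -/
lemma IsWeightDeriv.existsUnique_combination {m : ℕ} (hm : 1 ≤ m) {A B D : V K →ₗ[K] V K} {u v : K}
    (hu : u ≠ 0) (hv : v ≠ 0)
    (hA₀ : A (single 0 1) = u • single m 1) (hA : ∀ n : ℕ, A (single (n + 1) 1) = 0)
    (hB₀ : B (single 0 1) = 0) (hB : ∀ n : ℕ, B (single (n + 1) 1) = v • single (n + 1 + m) 1)
    (hD : IsWeightDeriv K m D) : ∃! st : K × K, D = st.1 • A + st.2 • B := by
  obtain ⟨a, b, ha, hb⟩ := (isWeightDeriv_iff K hm D).mp hD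
  refine ⟨(a / u, b / v), ?_, ?_⟩
  · refine Finsupp.lhom_ext' fun n => LinearMap.ext_ring ?_
    rcases n with _ | n
    · simp [ha, hA₀, hB₀, hu]
    · simp [hb, hA, hB, hv]
  · rintro ⟨s, t⟩ h
    have h₀ := DFunLike.congr_fun (LinearMap.congr_fun h (single 0 1)) m
    have h₁ := DFunLike.congr_fun (LinearMap.congr_fun h (single (0 + 1) 1)) (0 + 1 + m)
    rw [ha] at h₀
    rw [hb] at h₁
    simp only [LinearMap.add_apply, LinearMap.smul_apply, hA₀, hB₀] at h₀
    simp only [LinearMap.add_apply, LinearMap.smul_apply, hA, hB] at h₁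
    have ha' : a = s * u := by simpa using h₀
    have hb' : b = t * v := by simpa using h₁
    simp [ha', hb', hu, hv]

/-- For each integer `l ≥ 2`, the maps `α_l` and `ad(e_l)` are weight-`l` derivations of
`𝔪₀` and every weight-`l` derivation is uniquely a combination of them; likewise `γ` and
`ad(e_1)` in weight 1. In particular, for every `l ≥ 1` the space of weight-`l`
derivations of `𝔪₀` is 2-dimensional. -/
theorem positive_weight_derivations :
    (∀ l : ℤ, 2 ≤ l →
      IsWeightDeriv K l (alphaMap K l) ∧ IsWeightDeriv K l (adE K (l.toNat - 1)) ∧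
      ∀ D : V K →ₗ[K] V K, IsWeightDeriv K l D →
        ∃! st : K × K, D = st.1 • alphaMap K l + st.2 • adE K (l.toNat - 1)) ∧
    (IsWeightDeriv K 1 (gammaMap K) ∧ IsWeightDeriv K 1 (adE K 0) ∧
      ∀ D : V K →ₗ[K] V K, IsWeightDeriv K 1 D →
        ∃! st : K × K, D = st.1 • gammaMap K + st.2 • adE K 0) := by
  refine ⟨fun l hl => ?_, ?_⟩
  · obtain ⟨m, rfl⟩ : ∃ m : ℕ, l = ((m + 1 : ℕ) : ℤ) := ⟨(l - 1).toNat, by omega⟩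
    have hm : 1 ≤ m := by omega
    rw [Int.toNat_natCast, Nat.add_sub_cancel]
    refine ⟨(isWeightDeriv_iff K (by omega) _).mpr ⟨0, 1, ?_, fun n => ?_⟩,
      (isWeightDeriv_iff K (by omega) _).mpr ⟨-1, 0, ?_, fun n => ?_⟩, fun D hD => ?_⟩
    · rw [alphaMap_single_zero, zero_smul]
    · rw [alphaMap_natCast_single_succ, one_smul]
    · rw [adE_single_zero K hm, neg_one_smul]
    · rw [adE_single_succ K hm, zero_smul]
    · have h := hD.existsUnique_combination K (A := adE K m) (B := alphaMap K (m + 1 : ℕ))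
        (u := -1) (v := 1) (by omega) (by simp) one_ne_zero
        (by rw [adE_single_zero K hm, neg_one_smul]) (adE_single_succ K hm)
        (alphaMap_single_zero K _)
        (fun n => by rw [alphaMap_natCast_single_succ, one_smul])
      rw [← (Equiv.prodComm K K).existsUnique_congr_right]
      simpa [add_comm] using h
  · rw [← Nat.cast_one (R := ℤ)]
    refine ⟨(isWeightDeriv_iff K le_rfl _).mpr ⟨1, 0, ?_, fun n => ?_⟩,
      (isWeightDeriv_iff K le_rfl _).mpr ⟨0, 1, ?_, fun n => ?_⟩, fun D hD => ?_⟩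
    · rw [gammaMap_single_zero, one_smul]
    · rw [gammaMap_single_succ, zero_smul]
    · rw [adE_zero_single_zero, zero_smul]
    · rw [adE_zero_single_of_pos K (by omega), one_smul]
    · exact hD.existsUnique_combination K le_rfl one_ne_zero one_ne_zero
        (by rw [gammaMap_single_zero, one_smul]) (gammaMap_single_succ K)
        (adE_zero_single_zero K)
        (fun n => by rw [adE_zero_single_of_pos K (by omega), one_smul])
end

section
/- Let a : ℤ × ℤ → K be admissible with a(2,3) = a(2,4) = 0, satisfying the cocycle recurrence a(i+1,j) + a(i,j+1) = a(i,j) for all integers i,j ≥ 2 with i+j ≥ 6, and suppose that M_{−4}(a)(i,j,k) = 0 for all integers 2 ≤ i < j < k such that i+j ≠ 9, i+k ≠ 9 and j+k ≠ 9 (these are exactly the weight −4 Massey squares that cannot be compensated by a coboundary). Then a is a scalar multiple of the 4-family: there exists t ∈ K with a(i,j) = t·F_4(i,j) for all i,j. -/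
/-- `a : ℤ × ℤ → K` (curried) is admissible: antisymmetric, and vanishing whenever
one of the indices is `≤ 1`. -/
def IsAdmissible {K : Type*} [Field K] (a : ℤ → ℤ → K) : Prop :=
  (∀ i j : ℤ, a j i = -a i j) ∧ (∀ i j : ℤ, i ≤ 1 ∨ j ≤ 1 → a i j = 0)

/-- `a` satisfies the cocycle recurrence `a (i+1) j + a i (j+1) = a i j` for `i, j ≥ 2`. -/
def CocycleRec {K : Type*} [Field K] (a : ℤ → ℤ → K) : Prop :=
  ∀ i j : ℤ, 2 ≤ i → 2 ≤ j → a (i + 1) j + a i (j + 1) = a i j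

/-- The weight-`l` Massey square of `a`. -/
def MasseySq {K : Type*} [Field K] (l : ℤ) (a : ℤ → ℤ → K) (i j k : ℤ) : K :=
  a i j * a (i + j + l) k + a j k * a (j + k + l) i + a k i * a (k + i + l) j

/-- Auxiliary for the `m`-family: its values on pairs `(i,j)` with `2 ≤ i < j`. -/
def famAux (K : Type*) [Field K] (m i j : ℤ) : K :=
  if 2 ≤ i ∧ i < j ∧ i ≤ m ∧ m + 1 ≤ j then
    (-1 : K) ^ (m - i).toNat * ((j - m - 1).toNat.choose (m - i).toNat : K)
  else 0

/-- The `m`-family `F_m`: for `2 ≤ i < j`, `F_m(i,j) = (-1)^(m-i) * C(j-m-1, m-i)` if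
`i ≤ m` and `j ≥ m+1`, and `0` otherwise; extended antisymmetrically, and `0` when an
index is `≤ 1`. -/
def Fam (K : Type*) [Field K] (m i j : ℤ) : K := famAux K m i j - famAux K m j i

section LowerRows

variable {K : Type*} [Field K] {a : ℤ → ℤ → K}

/-- An antisymmetric function vanishes on the diagonal in characteristic zero. -/
lemma diag_eq_zero [CharZero K] (hanti : ∀ i j : ℤ, a j i = -a i j) (i : ℤ) : a i i = 0 :=
  self_eq_neg.mp (hanti i i)

variable (hrec : ∀ i j : ℤ, 2 ≤ i → 2 ≤ j → 6 ≤ i + j → a (i + 1) j + a i (j + 1) = a i j)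
include hrec

lemma row_three_eq {k : ℤ} (hk : 4 ≤ k) : a 3 k = a 2 k - a 2 (k + 1) := by
  have h := hrec 2 k (by lia) (by lia) (by lia)
  norm_num at h
  linear_combination h

lemma row_four_eq {k : ℤ} (hk : 4 ≤ k) :
    a 4 k = a 2 k - 2 * a 2 (k + 1) + a 2 (k + 2) := by
  have h := hrec 3 k (by lia) (by lia) (by lia)
  have h₀ := row_three_eq hrec hk
  have h₁ := row_three_eq hrec (k := k + 1) (by lia)
  rw [show k + 1 + 1 = k + 2 by ring] at h₁
  norm_num at h
  linear_combination h + h₀ - h₁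

lemma row_five_eq {k : ℤ} (hk : 4 ≤ k) :
    a 5 k = a 2 k - 3 * a 2 (k + 1) + 3 * a 2 (k + 2) - a 2 (k + 3) := by
  have h := hrec 4 k (by lia) (by lia) (by lia)
  have h₀ := row_four_eq hrec hk
  have h₁ := row_four_eq hrec (k := k + 1) (by lia)
  rw [show k + 1 + 1 = k + 2 by ring, show k + 1 + 2 = k + 3 by ring] at h₁
  norm_num at h
  linear_combination h + h₀ - h₁

lemma row_six_eq {k : ℤ} (hk : 4 ≤ k) :
    a 6 k = a 2 k - 4 * a 2 (k + 1) + 6 * a 2 (k + 2) - 4 * a 2 (k + 3) + a 2 (k + 4) := by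
  have h := hrec 5 k (by lia) (by lia) (by lia)
  have h₀ := row_five_eq hrec hk
  have h₁ := row_five_eq hrec (k := k + 1) (by lia)
  rw [show k + 1 + 1 = k + 2 by ring, show k + 1 + 2 = k + 3 by ring,
    show k + 1 + 3 = k + 4 by ring] at h₁
  norm_num at h
  linear_combination h + h₀ - h₁

/-- The square `M(2,3,k)` expressed through the second row. -/
lemma row_two_quadratic (hanti : ∀ i j : ℤ, a j i = -a i j) (h23 : a 2 3 = 0)
    {k : ℤ} (hk : 6 ≤ k) (hM : MasseySq (-4) a 2 3 k = 0) :
    2 * a 2 k * a 2 (k - 1) = a 2 (k + 1) * a 2 (k - 1) + a 2 k * a 2 (k - 2) := by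
  have h₀ := row_three_eq hrec (k := k) (by lia)
  have h₁ := row_three_eq hrec (k := k - 2) (by lia)
  rw [show k - 2 + 1 = k - 1 by ring] at h₁
  simp only [MasseySq, h23, zero_mul, zero_add] at hM
  rw [show 3 + k + -4 = k - 1 by ring, show k + 2 + -4 = k - 2 by ring, hanti 2 (k - 1),
    hanti 2 k, hanti 3 (k - 2), h₀, h₁] at hM
  linear_combination -hM

/-- The square `M(2,4,k)` gives a linear recurrence wherever the second row is nonzero. -/
lemma row_two_linear (hanti : ∀ i j : ℤ, a j i = -a i j) (h24 : a 2 4 = 0)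
    {k : ℤ} (hk : 6 ≤ k) (hM : MasseySq (-4) a 2 4 k = 0) (h : a 2 k ≠ 0) :
    a 2 (k + 2) = 2 * a 2 (k + 1) + a 2 (k - 2) - 2 * a 2 (k - 1) := by
  have h₀ := row_four_eq hrec (k := k) (by lia)
  have h₁ := row_four_eq hrec (k := k - 2) (by lia)
  rw [show k - 2 + 1 = k - 1 by ring, show k - 2 + 2 = k by ring] at h₁
  simp only [MasseySq, h24, zero_mul, zero_add] at hM
  rw [show 4 + k + -4 = k by ring, show k + 2 + -4 = k - 2 by ring,
    hanti 2 k, hanti 4 (k - 2), h₀, h₁] at hM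
  refine mul_left_cancel₀ h ?_
  linear_combination -hM

/-- If the second row vanishes before `s`, the values of `a` on the first four nontrivial
antidiagonals are given by the first four nontrivial entries of the second row. -/
lemma antidiagonals_of_row_two_eq_zero [CharZero K] {s : ℤ}
    (hz : ∀ j, 2 ≤ j → j < s → a 2 j = 0) (n : ℕ) :
    (∀ j, 4 ≤ j → j + n < s → a (n + 2) j = 0) ∧
    (∀ j, 4 ≤ j → j + n = s → a (n + 2) j = (-1) ^ n * a 2 s) ∧
    (∀ j, 4 ≤ j → j + n = s + 1 → a (n + 2) j = (-1) ^ n * (a 2 (s + 1) - n * a 2 s)) ∧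
    (∀ j, 4 ≤ j → j + n = s + 2 → a (n + 2) j =
      (-1) ^ n * (a 2 (s + 2) - n * a 2 (s + 1) + n * (n - 1) / 2 * a 2 s)) ∧
    (∀ j, 4 ≤ j → j + n = s + 3 → a (n + 2) j =
      (-1) ^ n * (a 2 (s + 3) - n * a 2 (s + 2) + n * (n - 1) / 2 * a 2 (s + 1)
        - n * (n - 1) * (n - 2) / 6 * a 2 s)) := by
  induction n with
  | zero =>
    refine ⟨fun j hj h => ?_, fun j hj h => ?_, fun j hj h => ?_, fun j hj h => ?_,
      fun j hj h => ?_⟩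
    · simpa using hz j (by lia) (by simpa using h)
    all_goals
      simp only [Nat.cast_zero, add_zero] at h
      subst h
      simp
  | succ n ih =>
    obtain ⟨ih₀, ih₁, ih₂, ih₃, ih₄⟩ := ih
    have step : ∀ j : ℤ, 4 ≤ j → a ((n + 1 : ℕ) + 2) j = a (n + 2) j - a (n + 2) (j + 1) := by
      intro j hj
      have h := hrec (n + 2) j (by lia) (by lia) (by lia)
      rw [show ((n + 1 : ℕ) + 2 : ℤ) = n + 2 + 1 by push_cast; ring]
      linear_combination h
    refine ⟨fun j hj h => ?_, fun j hj h => ?_, fun j hj h => ?_, fun j hj h => ?_,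
      fun j hj h => ?_⟩ <;> rw [step j hj] <;> push_cast at h ⊢
    · rw [ih₀ j hj (by lia), ih₀ (j + 1) (by lia) (by lia), sub_zero]
    · rw [ih₀ j hj (by lia), ih₁ (j + 1) (by lia) (by lia)]
      ring
    · rw [ih₁ j hj (by lia), ih₂ (j + 1) (by lia) (by lia)]
      ring
    · rw [ih₂ j hj (by lia), ih₃ (j + 1) (by lia) (by lia)]
      field_simp
      ring
    · rw [ih₃ j hj (by lia), ih₄ (j + 1) (by lia) (by lia)]
      field_simp
      ring

/-- The second row cannot start with a nonzero entry in position `2 * q + 1` for `q ≥ 4`. -/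
lemma row_two_next_eq_zero [CharZero K] (hanti : ∀ i j : ℤ, a j i = -a i j) (h24 : a 2 4 = 0)
    (hM : ∀ k : ℤ, 8 ≤ k → MasseySq (-4) a 2 4 k = 0) {q : ℕ} (hq : 4 ≤ q)
    (hz : ∀ j : ℤ, 2 ≤ j → j < 2 * q + 1 → a 2 j = 0) :
    a 2 (2 * q + 1) = 0 ∧ a 2 (2 * q + 2) = 0 := by
  have hq0 : (q : K) ≠ 0 := by exact_mod_cast (by lia : q ≠ 0)
  have hB : a 2 (2 * q + 2) = q * a 2 (2 * q + 1) := by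
    have h := (antidiagonals_of_row_two_eq_zero hrec hz q).2.2.1 (q + 2) (by lia) (by lia)
    rw [diag_eq_zero hanti, show (2 * q + 1 + 1 : ℤ) = 2 * q + 2 by ring, eq_comm,
      mul_eq_zero_iff_left (by simp)] at h
    linear_combination h
  suffices hA : a 2 (2 * q + 1) = 0 from ⟨hA, by rw [hB, hA, mul_zero]⟩
  by_contra hA
  have hC := row_two_linear hrec hanti h24 (by lia) (hM (2 * q + 1) (by lia)) hA
  have hD := row_two_linear hrec hanti h24 (by lia) (hM (2 * q + 2) (by lia))
    (by rw [hB]; exact mul_ne_zero hq0 hA)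
  have h := (antidiagonals_of_row_two_eq_zero hrec hz (q + 1)).2.2.2.2 (q + 3) (by lia)
    (by push_cast; ring)
  rw [show (((q + 1 : ℕ) : ℤ) + 2) = q + 3 by push_cast; ring, diag_eq_zero hanti, eq_comm,
    mul_eq_zero_iff_left (by simp)] at h
  have hz₀ := hz (2 * q) (by lia) (by lia)
  have hz₁ := hz (2 * q - 1) (by lia) (by lia)
  ring_nf at hB hC hD h hA hz₀ hz₁
  rw [hz₀, hz₁] at hC
  rw [hz₀] at hD
  push_cast at h
  have key : ((q : K) - 3) * (2 * q ^ 2 - 3 * q + 4) * a 2 (1 + q * 2) = 0 := by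
    rw [hD, hC, hB] at h
    linear_combination 6 * h
  refine mul_ne_zero ?_ hA key
  obtain ⟨r, rfl⟩ := Nat.exists_eq_add_of_le hq
  have hr : (((r + 1) * (2 * r ^ 2 + 13 * r + 24) : ℕ) : K) ≠ 0 :=
    Nat.cast_ne_zero.mpr (by positivity)
  convert hr using 1
  push_cast
  ring

/-- If the second row vanishes up to position `8`, it vanishes identically. -/
lemma row_two_eq_zero [CharZero K] (hanti : ∀ i j : ℤ, a j i = -a i j) (h24 : a 2 4 = 0)
    (hM : ∀ k : ℤ, 8 ≤ k → MasseySq (-4) a 2 4 k = 0)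
    (hz : ∀ j : ℤ, 2 ≤ j → j < 9 → a 2 j = 0) {k : ℤ} (hk : 2 ≤ k) : a 2 k = 0 := by
  have main : ∀ n : ℕ, ∀ j : ℤ, 2 ≤ j → j < 2 * (n + 4 : ℕ) + 1 → a 2 j = 0 := by
    intro n
    induction n with
    | zero => exact fun j h₀ h₁ => hz j h₀ (by simpa using h₁)
    | succ n ih =>
      intro j h₀ h₁
      obtain ⟨h₂, h₃⟩ := row_two_next_eq_zero hrec hanti h24 hM (by lia) ih
      rcases lt_or_ge j (2 * (n + 4 : ℕ) + 1) with h | h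
      · exact ih j h₀ h
      · obtain rfl | rfl : j = 2 * (n + 4 : ℕ) + 1 ∨ j = 2 * (n + 4 : ℕ) + 2 := by lia
        exacts [h₂, h₃]
  exact main k.toNat k hk (by lia)

/-- The Massey squares `M(2,3,8)` and `M(2,4,k)` determine the second row up to scaling. -/
lemma row_two_eq_choose [CharZero K] (hanti : ∀ i j : ℤ, a j i = -a i j) (h23 : a 2 3 = 0)
    (h24 : a 2 4 = 0) (hM3 : MasseySq (-4) a 2 3 8 = 0)
    (hM4 : ∀ k : ℤ, 6 ≤ k → k ≠ 7 → MasseySq (-4) a 2 4 k = 0) (n : ℕ) :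
    a 2 (n + 5) = a 2 7 * n.choose 2 := by
  have h6 : a 2 6 = 2 * a 2 5 := by
    have h := row_four_eq hrec (k := 4) (by lia)
    norm_num [diag_eq_zero hanti, h24] at h
    linear_combination -h
  have h8 : a 2 8 = 3 * a 2 7 - 5 * a 2 5 := by
    have h := row_five_eq hrec (k := 5) (by lia)
    norm_num [diag_eq_zero hanti] at h
    linear_combination h - 3 * h6
  have h10 : a 2 6 - 4 * a 2 7 + 6 * a 2 8 - 4 * a 2 9 + a 2 10 = 0 := by
    have h := row_six_eq hrec (k := 6) (by lia)
    norm_num [diag_eq_zero hanti] at h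
    linear_combination -h
  have h9 (h : a 2 8 ≠ 0) : a 2 10 = 2 * a 2 9 + a 2 6 - 2 * a 2 7 := by
    have := row_two_linear hrec hanti h24 (by lia) (hM4 8 (by lia) (by lia)) h
    norm_num at this
    exact this
  have h5 : a 2 5 = 0 := by
    by_contra h5
    have h7 := row_two_linear hrec hanti h24 le_rfl (hM4 6 (by lia) (by lia))
      (by rw [h6]; exact mul_ne_zero two_ne_zero h5)
    norm_num [h24] at h7
    have h7' : a 2 7 = 3 * a 2 5 := by linear_combination h7 - h8
    have h8' : a 2 8 = 4 * a 2 5 := by linear_combination h8 + 3 * h7'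
    have h10' := h9 (by rw [h8']; exact mul_ne_zero (by norm_num) h5)
    have h9' : a 2 9 = 5 * a 2 5 := by
      linear_combination (1 / 2) * (h10' - h10 + 2 * h6 - 6 * h7' + 6 * h8')
    have hq := row_two_quadratic hrec hanti h23 (by lia) hM3
    norm_num at hq
    rw [h9', h8', h7', h6] at hq
    exact pow_ne_zero 2 h5 (by linear_combination hq)
  simp only [h5, mul_zero, sub_zero] at h6 h8
  by_cases h7 : a 2 7 = 0
  · rw [h7, zero_mul]
    refine row_two_eq_zero hrec hanti h24 (fun k hk => hM4 k (by lia) (by lia)) ?_ (by lia)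
    intro j hj hj'
    have h22 := diag_eq_zero hanti 2
    rw [h7, mul_zero] at h8
    interval_cases j <;> assumption
  have h10' := h9 (by rw [h8]; exact mul_ne_zero three_ne_zero h7)
  have h9' : a 2 9 = 6 * a 2 7 := by
    linear_combination (1 / 2) * (h10' - h10 + 2 * h6 + 6 * h8)
  induction n using Nat.strong_induction_on with
  | _ n ih =>
    rcases lt_or_ge n 6 with hn | hn
    · have h11 : a 2 10 = 10 * a 2 7 := by linear_combination h10' + 2 * h9' + h6
      interval_cases n <;> norm_num [Nat.choose] <;>
        first | assumption | linear_combination h8 | linear_combination h9' | linear_combination h11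
    · obtain ⟨m, rfl⟩ := Nat.exists_eq_add_of_le' hn
      have e₂ := ih (m + 2) (by lia)
      have e₃ := ih (m + 3) (by lia)
      have e₄ := ih (m + 4) (by lia)
      have e₅ := ih (m + 5) (by lia)
      have hne : a 2 ((m + 4 : ℕ) + 5) ≠ 0 := by
        rw [e₄]
        exact mul_ne_zero h7 (Nat.cast_ne_zero.mpr (Nat.choose_pos (by lia)).ne')
      have h := row_two_linear hrec hanti h24 (by lia) (hM4 _ (by lia) (by lia)) hne
      push_cast [Nat.cast_choose_two] at e₂ e₃ e₅ h ⊢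
      ring_nf at e₂ e₃ e₅ h ⊢
      rw [h, e₂, e₃, e₅]
      ring

end LowerRows

section FourFamily

variable (K : Type*) [Field K]

lemma fam_swap (m i j : ℤ) : Fam K m j i = -Fam K m i j := by
  simp [Fam]

lemma fam_four_eq_zero {i j : ℤ} (hij : i ≤ j) (h : i ≤ 1 ∨ j ≤ 4 ∨ 5 ≤ i) :
    Fam K 4 i j = 0 := by
  rw [Fam, famAux, famAux, if_neg (by lia), if_neg (by lia), sub_zero]

lemma fam_four_two (n : ℕ) : Fam K 4 2 (n + 5) = n.choose 2 := by
  rw [Fam, famAux, famAux, if_pos (by lia), if_neg (by lia),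
    show ((n : ℤ) + 5 - 4 - 1).toNat = n by lia]
  simp

lemma fam_four_three (n : ℕ) : Fam K 4 3 (n + 5) = -n := by
  rw [Fam, famAux, famAux, if_pos (by lia), if_neg (by lia),
    show ((n : ℤ) + 5 - 4 - 1).toNat = n by lia]
  simp

lemma fam_four_four (n : ℕ) : Fam K 4 4 (n + 5) = 1 := by
  rw [Fam, famAux, famAux, if_pos (by lia), if_neg (by lia),
    show ((n : ℤ) + 5 - 4 - 1).toNat = n by lia]
  simp

end FourFamily

/-- Classification in weight `-4`: if `a` is admissible with `a 2 3 = a 2 4 = 0`,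
satisfies the cocycle recurrence for `i, j ≥ 2` with `i + j ≥ 6`, and all
non-compensable weight-`(-4)` Massey squares vanish (i.e. `M(i,j,k) = 0` for
`2 ≤ i < j < k` with `i+j ≠ 9`, `i+k ≠ 9`, `j+k ≠ 9`), then `a` is a scalar multiple
of the 4-family. -/
theorem weight_neg_four_classification (K : Type*) [Field K] [CharZero K]
    (a : ℤ → ℤ → K) (ha : IsAdmissible a) (h23 : a 2 3 = 0) (h24 : a 2 4 = 0)
    (hrec : ∀ i j : ℤ, 2 ≤ i → 2 ≤ j → 6 ≤ i + j →
      a (i + 1) j + a i (j + 1) = a i j)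
    (hM : ∀ i j k : ℤ, 2 ≤ i → i < j → j < k →
      i + j ≠ 9 → i + k ≠ 9 → j + k ≠ 9 → MasseySq (-4) a i j k = 0) :
    ∃ t : K, ∀ i j : ℤ, a i j = t * Fam K 4 i j := by
  obtain ⟨hanti, hadm⟩ := ha
  have h2 := row_two_eq_choose hrec hanti h23 h24
    (hM 2 3 8 (by lia) (by lia) (by lia) (by lia) (by lia) (by lia))
    (fun k hk hk7 => hM 2 4 k (by lia) (by lia) (by lia) (by lia) (by lia) (by lia))
  have h3 (n : ℕ) : a 3 (n + 5) = a 2 7 * -n := by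
    have e₁ := h2 (n + 1)
    rw [show ((n + 1 : ℕ) + 5 : ℤ) = n + 5 + 1 by push_cast; ring] at e₁
    rw [row_three_eq hrec (by lia), e₁, h2]
    push_cast [Nat.cast_choose_two]
    ring
  have h4 (n : ℕ) : a 4 (n + 5) = a 2 7 := by
    have e₁ := h2 (n + 1)
    have e₂ := h2 (n + 2)
    rw [show ((n + 1 : ℕ) + 5 : ℤ) = n + 5 + 1 by push_cast; ring] at e₁
    rw [show ((n + 2 : ℕ) + 5 : ℤ) = n + 5 + 2 by push_cast; ring] at e₂
    rw [row_four_eq hrec (by lia), e₁, e₂, h2]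
    push_cast [Nat.cast_choose_two]
    ring
  have h5 (m : ℕ) : ∀ j : ℤ, 5 ≤ j → a (m + 5) j = 0 := by
    induction m with
    | zero =>
      intro j hj
      obtain ⟨n, rfl⟩ := Int.le.dest hj
      have h := hrec 4 (5 + n) (by lia) (by lia) (by lia)
      have e₀ := h4 n
      have e₁ := h4 (n + 1)
      push_cast at e₁
      ring_nf at h e₀ e₁ ⊢
      linear_combination h + e₀ - e₁
    | succ m ih =>
      intro j hj
      have h := hrec (m + 5) j (by lia) (by lia) (by lia)
      rw [ih j hj, ih (j + 1) (by lia), add_zero] at h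
      rw [← h]
      congr 1
  have h34 : a 3 4 = 0 := by
    have e := h2 0
    norm_num at e
    have h := row_three_eq hrec (k := 4) le_rfl
    norm_num [h24, e] at h
    exact h
  refine ⟨a 2 7, ?_⟩
  suffices hle : ∀ i j : ℤ, i < j → a i j = a 2 7 * Fam K 4 i j by
    intro i j
    rcases lt_trichotomy i j with h | rfl | h
    · exact hle i j h
    · rw [diag_eq_zero hanti, Fam, sub_self, mul_zero]
    · rw [hanti j i, hle j i h, fam_swap K 4 j i, mul_neg]
  intro i j hij
  by_cases hi : i ≤ 1
  · rw [hadm i j (Or.inl hi), fam_four_eq_zero K hij.le (Or.inl hi), mul_zero]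
  by_cases hi5 : 5 ≤ i
  · obtain ⟨m, rfl⟩ := Int.le.dest hi5
    rw [fam_four_eq_zero K hij.le (by lia), mul_zero, add_comm, h5 m j (by lia)]
  by_cases hj : j ≤ 4
  · rw [fam_four_eq_zero K hij.le (by lia), mul_zero]
    obtain ⟨rfl, rfl⟩ | ⟨rfl, rfl⟩ | ⟨rfl, rfl⟩ :
        (i = 2 ∧ j = 3) ∨ (i = 2 ∧ j = 4) ∨ (i = 3 ∧ j = 4) := by lia
    exacts [h23, h24, h34]
  obtain ⟨n, rfl⟩ := Int.le.dest (show 5 ≤ j by lia)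
  rw [add_comm 5 (n : ℤ)]
  obtain rfl | rfl | rfl : i = 2 ∨ i = 3 ∨ i = 4 := by lia
  · rw [h2, fam_four_two]
  · rw [h3, fam_four_three]
  · rw [h4, fam_four_four, mul_one]
end
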